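/- Let (b_n)_{n≥1} be a nondecreasing sequence of reals with b_1 ≥ 1, and suppose there is D > 0 with b_n ≤ D·(e↑↑(n−2)) for all n ≥ 2. Let g : (0,∞) → [1,∞) be nondecreasing with g(e↑↑n) = b_n for all n ≥ 1, and define f : (0,∞) → [1,∞) by f(t) = max(1, log^{(1)} t) · max(1, log^{(2)} t)² · Π_{i=3}^∞ max(1, log^{(i)} t) · g(t) (for each t only finitely many factors differ from 1). Then ∫_{e↑↑2}^∞ (log f(x))/(x·f(x)) dx = ∞ if and only if Σ_{n=1}^∞ 1/b_n = ∞. -/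

import Mathlib

open MeasureTheory Real Set Filter

/-- The power tower `e ↑↑ n`: `towE 0 = 1`, `towE (n+1) = exp (towE n)`. -/
noncomputable def towE : ℕ → ℝ
  | 0 => 1
  | n + 1 => Real.exp (towE n)

/-- Iterated logarithm: `iterLog 0 t = t`, and
`iterLog (n+1) t = log (iterLog n t)` if `iterLog n t > 1`, else `0`. -/
noncomputable def iterLog : ℕ → ℝ → ℝ
  | 0, t => t
  | n + 1, t => if 1 < iterLog n t then Real.log (iterLog n t) else 0

/-- The function `f(t) = max(1, log^{(1)} t) · max(1, log^{(2)} t)² ·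
∏_{i=3}^∞ max(1, log^{(i)} t) · g(t)`; for each `t` only finitely many
factors of the infinite product differ from `1`. -/
noncomputable def F (g : ℝ → ℝ) (t : ℝ) : ℝ :=
  max 1 (iterLog 1 t) * (max 1 (iterLog 2 t)) ^ 2 *
    (∏' i : ℕ, max 1 (iterLog (i + 3) t)) * g t

lemma towE_pos (n : ℕ) : 0 < towE n := by
  cases n with
  | zero => simp [towE]
  | succ n => exact Real.exp_pos _

lemma towE_lt_succ (n : ℕ) : towE n < towE (n + 1) := by
  have := Real.add_one_le_exp (towE n)
  simp only [towE]
  linarith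

lemma towE_one_le (n : ℕ) : 1 ≤ towE n := by
  induction n with
  | zero => simp [towE]
  | succ n ih => exact ih.trans (towE_lt_succ n).le

lemma towE_ge (n : ℕ) : (n : ℝ) ≤ towE n := by
  induction n with
  | zero => simp [towE]
  | succ n ih =>
    have := Real.add_one_le_exp (towE n)
    simp only [towE]
    push_cast
    linarith

lemma towE_mono : Monotone towE := monotone_nat_of_le_succ fun n => (towE_lt_succ n).le

lemma iterLog_succ (k : ℕ) (x : ℝ) : iterLog (k + 1) x = Real.log (max 1 (iterLog k x)) := by
  simp only [iterLog]
  split_ifs with h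
  · rw [max_eq_right h.le]
  · rw [max_eq_left (not_lt.1 h), Real.log_one]

lemma iterLog_cont (k : ℕ) : Continuous (iterLog k) := by
  induction k with
  | zero => exact continuous_id
  | succ k ih =>
    have : iterLog (k + 1) = fun x => Real.log (max 1 (iterLog k x)) := funext (iterLog_succ k)
    rw [this]
    refine Continuous.log (by fun_prop) fun x => ?_
    have := le_max_left 1 (iterLog k x)
    positivity

lemma lt_iterLog (k : ℕ) : ∀ (j : ℕ) (x : ℝ), towE (j + k) < x → towE j < iterLog k x := by
  induction k with
  | zero => intro j x h; exact h
  | succ k ih =>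
    intro j x h
    have h1 := ih (j + 1) x (by rwa [show j + 1 + k = j + (k + 1) by ring])
    have h2 : 1 < iterLog k x := (towE_one_le _).trans_lt h1
    rw [iterLog_succ, max_eq_right h2.le, Real.lt_log_iff_exp_lt (by linarith)]
    exact h1

lemma iterLog_le (k : ℕ) : ∀ (j : ℕ) (x : ℝ), x ≤ towE (j + k) → iterLog k x ≤ towE j := by
  induction k with
  | zero => intro j x h; exact h
  | succ k ih =>
    intro j x h
    have h1 := ih (j + 1) x (by rwa [show j + 1 + k = j + (k + 1) by ring])
    rw [iterLog_succ, Real.log_le_iff_le_exp (by positivity)]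
    exact max_le (towE_one_le (j + 1)) h1

lemma iterLog_tow (k : ℕ) : ∀ j : ℕ, iterLog k (towE (j + k)) = towE j := by
  induction k with
  | zero => intro j; rfl
  | succ k ih =>
    intro j
    rw [iterLog_succ, show j + (k + 1) = j + 1 + k by ring, ih, max_eq_right (towE_one_le _)]
    exact Real.log_exp _

lemma iterLog_le_one (n j : ℕ) (x : ℝ) (h : x ≤ towE n) (hj : n ≤ j) : iterLog j x ≤ 1 := by
  have := iterLog_le j 0 x (h.trans (towE_mono (by omega)))
  exact this

lemma iterLog_deriv (n : ℕ) (x : ℝ) (h : ∀ k < n, 1 < iterLog k x) :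
    HasDerivAt (iterLog n) (1 / ∏ i ∈ Finset.range n, iterLog i x) x := by
  induction n with
  | zero => simpa using! hasDerivAt_id x
  | succ n ih =>
    have h1 := ih fun k hk => h k (by omega)
    have hn := h n (by omega)
    have h2 := h1.log (by linarith : iterLog n x ≠ 0)
    have h3 : iterLog (n + 1) =ᶠ[nhds x] fun y => Real.log (iterLog n y) := by
      filter_upwards [(iterLog_cont n).continuousAt.eventually (lt_mem_nhds hn)] with y hy
      rw [iterLog_succ, max_eq_right hy.le]
    have h4 := h2.congr_of_eventuallyEq h3
    rw [Finset.prod_range_succ, ← div_div]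
    exact h4

lemma one_lt_iterLog (n k : ℕ) (x : ℝ) (h : towE n < x) (hk : k ≤ n) : 1 < iterLog k x := by
  have := lt_iterLog k (n - k) x (by rwa [Nat.sub_add_cancel hk])
  exact (towE_one_le _).trans_lt this

lemma lint_one (n : ℕ) : ∫⁻ x in Ioc (towE n) (towE (n + 1)),
    ENNReal.ofReal (1 / ∏ i ∈ Finset.range (n + 1), iterLog i x) = 1 := by
  have hd : ∀ x ∈ Ioo (towE n) (towE (n + 1)), HasDerivAt (iterLog (n + 1))
      (1 / ∏ i ∈ Finset.range (n + 1), iterLog i x) x := fun x hx =>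
    iterLog_deriv _ _ fun k hk => one_lt_iterLog n k x hx.1 (by omega)
  have hpos : ∀ x, towE n < x → 0 ≤ 1 / ∏ i ∈ Finset.range (n + 1), iterLog i x := by
    intro x hx
    refine one_div_nonneg.2 (Finset.prod_nonneg fun k hk => ?_)
    have := one_lt_iterLog n k x hx (by simp at hk; omega)
    linarith
  have hint := intervalIntegral.integrableOn_deriv_of_nonneg (iterLog_cont (n + 1)).continuousOn hd
    fun x hx => hpos x hx.1
  have hle := (towE_lt_succ n).le
  have key := intervalIntegral.integral_eq_sub_of_hasDerivAt_of_le hle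
    (iterLog_cont (n + 1)).continuousOn hd
    ((intervalIntegrable_iff_integrableOn_Ioc_of_le hle).2 hint)
  rw [intervalIntegral.integral_of_le hle] at key
  rw [← ofReal_integral_eq_lintegral_ofReal hint, key]
  · have h1 := iterLog_tow (n + 1) 0
    have h2 := iterLog_tow n 0
    rw [zero_add] at h1 h2
    rw [h1, iterLog_succ, h2]
    simp [towE]
  · exact (ae_restrict_iff' measurableSet_Ioc).2 (ae_of_all _ fun x hx => hpos x hx.1)

lemma sq_le_exp_self (y : ℝ) (hy : 0 ≤ y) : y ^ 2 ≤ Real.exp y := by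
  have h := Real.quadratic_le_exp_of_nonneg (by linarith : 0 ≤ y / 2)
  have h2 : y ≤ Real.exp (y / 2) := by nlinarith [sq_nonneg (y - 2)]
  calc y ^ 2 ≤ Real.exp (y / 2) ^ 2 := by gcongr
    _ = Real.exp y := by rw [← Real.exp_nat_mul]; congr 1; push_cast; ring

lemma prod_le_exp (x : ℝ) (m : ℕ) : ∀ k : ℕ, (∀ i ≤ m, 1 < iterLog (i + k) x) →
    ∏ i ∈ Finset.range (m + 1), iterLog (i + k) x ≤ Real.exp (iterLog k x) := by
  induction m with
  | zero =>
    intro k _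
    have := Real.add_one_le_exp (iterLog k x)
    simp
    linarith
  | succ m ih =>
    intro k h
    have h0 : 1 < iterLog k x := by simpa using h 0 (by omega)
    have h1 := ih (k + 1) fun i hi => by
      have := h (i + 1) (by omega)
      rwa [show i + (k + 1) = i + 1 + k by ring]
    rw [iterLog_succ, max_eq_right h0.le, Real.exp_log (by linarith)] at h1
    rw [Finset.prod_range_succ']
    have h2 := sq_le_exp_self (iterLog k x) (by linarith)
    simp only [show ∀ i, i + (k + 1) = i + 1 + k from fun i => by ring] at h1
    rw [zero_add]
    nlinarith

lemma b_one_le (b : ℕ → ℝ) (hmono : ∀ n, b n ≤ b (n + 1)) (hb1 : 1 ≤ b 1) (n : ℕ) :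
    1 ≤ b (n + 1) := by
  induction n with
  | zero => exact hb1
  | succ n ih => exact ih.trans (hmono _)

lemma bounds (D : ℝ) (hD : 0 < D) (m : ℕ) (x G β γ : ℝ) (g : ℝ → ℝ)
    (hx1 : towE (m + 2) < x) (hx2 : x ≤ towE (m + 3)) (hG : g x = G)
    (hβ : 1 ≤ β) (hβG : β ≤ G) (hGγ : G ≤ γ) (hγ : γ ≤ D * towE (m + 1)) :
    1 / γ * (1 / ∏ i ∈ Finset.range (m + 3), iterLog i x) ≤ Real.log (F g x) / (x * F g x) ∧
    Real.log (F g x) / (x * F g x) ≤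
      (4 + |Real.log D|) / β * (1 / ∏ i ∈ Finset.range (m + 3), iterLog i x) := by
  have hL : ∀ k ≤ m + 2, 1 < iterLog k x := fun k hk => one_lt_iterLog _ k x hx1 hk
  have hA := hL 1 (by omega)
  have hB := hL 2 (by omega)
  have hX : 1 < x := hL 0 (by omega)
  have hAB : Real.log (iterLog 1 x) = iterLog 2 x := by
    rw [iterLog_succ 1, max_eq_right hA.le]
  have hBt : towE m < iterLog 2 x := lt_iterLog 2 m x hx1
  have htp : (∏' i : ℕ, max 1 (iterLog (i + 3) x)) = ∏ i ∈ Finset.range m, iterLog (i + 3) x := by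
    rw [tprod_eq_prod (s := Finset.range m)]
    · refine Finset.prod_congr rfl fun i hi => max_eq_right (hL _ ?_).le
      simp at hi; omega
    · intro i hi
      refine max_eq_left (iterLog_le_one _ _ x hx2 ?_)
      simp at hi; omega
  have hQ1 : 1 ≤ ∏ i ∈ Finset.range m, iterLog (i + 3) x := by
    refine Finset.prod_induction _ (fun y => (1 : ℝ) ≤ y) (fun a c ha hc => by nlinarith) le_rfl
      fun i hi => (hL _ ?_).le
    simp at hi; omega
  have hPr := prod_le_exp x m 2 fun i hi => hL _ (by omega)
  rw [Finset.prod_range_succ'] at hPr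
  have hF : F g x = iterLog 1 x * iterLog 2 x ^ 2 *
      (∏ i ∈ Finset.range m, iterLog (i + 3) x) * G := by
    rw [F, htp, max_eq_right hA.le, max_eq_right hB.le, hG]
  have hDen : ∏ i ∈ Finset.range (m + 3), iterLog i x =
      x * iterLog 1 x * iterLog 2 x * ∏ i ∈ Finset.range m, iterLog (i + 3) x := by
    rw [Finset.prod_range_succ', Finset.prod_range_succ', Finset.prod_range_succ']
    simp only [iterLog.eq_1, zero_add, add_assoc, Nat.reduceAdd]
    ring
  simp only [show ∀ i, i + 1 + 2 = i + 3 from fun i => by ring, zero_add] at hPr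
  rw [hF, hDen]
  generalize (∏ i ∈ Finset.range m, iterLog (i + 3) x) = Q at *
  generalize iterLog 1 x = A at *
  generalize iterLog 2 x = B at *
  have hQ0 : 0 < Q := by linarith
  have hA0 : 0 < A := by linarith
  have hB0 : 0 < B := by linarith
  have hG1 : 1 ≤ G := hβ.trans hβG
  have hG0 : 0 < G := by linarith
  have hlogF : Real.log (A * B ^ 2 * Q * G) = B + Real.log B + Real.log (Q * B) + Real.log G := by
    rw [Real.log_mul (by positivity) (by positivity), Real.log_mul (by positivity) (by positivity),
      Real.log_mul (by positivity) (by positivity), Real.log_mul (by positivity) (by positivity),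
      Real.log_pow, hAB]
    push_cast
    ring
  have e1 : 0 ≤ Real.log B := Real.log_nonneg hB.le
  have e2 : 0 ≤ Real.log (Q * B) := Real.log_nonneg (by nlinarith)
  have e3 : 0 ≤ Real.log G := Real.log_nonneg hG1
  have u1 : Real.log B ≤ B := by linarith [Real.log_le_sub_one_of_pos hB0]
  have u2 : Real.log (Q * B) ≤ B := (Real.log_le_iff_le_exp (by positivity)).2 hPr
  have u3 : Real.log G ≤ (1 + |Real.log D|) * B := by
    have := Real.log_le_log hG0 (hGγ.trans hγ)
    rw [Real.log_mul hD.ne' (towE_pos _).ne', towE, Real.log_exp] at this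
    have := le_abs_self (Real.log D)
    nlinarith [abs_nonneg (Real.log D)]
  have hγ0 : 0 < γ := by linarith
  have hβ0 : 0 < β := by linarith
  have hX0 : 0 < x := by linarith
  rw [hlogF]
  constructor
  · calc 1 / γ * (1 / (x * A * B * Q)) = B / (x * (A * B ^ 2 * Q * γ)) := by field_simp
      _ ≤ B / (x * (A * B ^ 2 * Q * G)) := by gcongr
      _ ≤ _ := by gcongr; linarith
  · calc _ ≤ ((4 + |Real.log D|) * B) / (x * (A * B ^ 2 * Q * G)) := by gcongr; linarith
      _ ≤ ((4 + |Real.log D|) * B) / (x * (A * B ^ 2 * Q * β)) := by gcongr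
      _ = _ := by field_simp

lemma union_eq : Ioi (towE 2) = ⋃ m : ℕ, Ioc (towE (m + 2)) (towE (m + 3)) := by
  ext x
  simp only [mem_Ioi, mem_iUnion, mem_Ioc]
  constructor
  · intro hx
    have hex : ∃ n : ℕ, x ≤ towE n := by
      obtain ⟨n, hn⟩ := exists_nat_ge x
      exact ⟨n, hn.trans (towE_ge n)⟩
    classical
    have h1 := Nat.find_spec hex
    have h2 : 2 < Nat.find hex := by
      by_contra! h
      exact absurd (h1.trans (towE_mono h)) (not_le.2 hx)
    refine ⟨Nat.find hex - 3, ?_, ?_⟩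
    · have := Nat.find_min hex (m := Nat.find hex - 3 + 2) (by omega)
      exact not_le.1 this
    · rwa [Nat.sub_add_cancel (by omega)]
  · rintro ⟨m, h, _⟩
    exact (towE_mono (by omega)).trans_lt h

lemma union_disj : Pairwise (Function.onFun Disjoint
    fun m : ℕ => Ioc (towE (m + 2)) (towE (m + 3))) := by
  have h : Monotone fun m : ℕ => towE (m + 2) := fun a b hab => towE_mono (by omega)
  exact h.pairwise_disjoint_on_Ioc_succ

theorem stmt_10 (D : ℝ) (hD : 0 < D) (b : ℕ → ℝ) (g : ℝ → ℝ)
    (hmono : ∀ n, b n ≤ b (n + 1)) (hb1 : 1 ≤ b 1)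
    (hbD : ∀ n, 2 ≤ n → b n ≤ D * towE (n - 2))
    (hg1 : ∀ x : ℝ, 0 < x → 1 ≤ g x)
    (hgmono : ∀ x y : ℝ, 0 < x → x ≤ y → g x ≤ g y)
    (hgb : ∀ n : ℕ, 1 ≤ n → g (towE n) = b n) :
    (∫⁻ x in Set.Ioi (towE 2),
        ENNReal.ofReal (Real.log (F g x) / (x * F g x))) = ⊤ ↔
    (∑' n : ℕ, ENNReal.ofReal (1 / b (n + 1))) = ⊤ := by
  have hb := b_one_le b hmono hb1
  rw [union_eq, lintegral_iUnion (fun m => measurableSet_Ioc) union_disj]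
  have hbd := fun (m : ℕ) (x : ℝ) (hx : x ∈ Ioc (towE (m + 2)) (towE (m + 3))) =>
    bounds D hD m x (g x) (b (m + 2)) (b (m + 3)) g hx.1 hx.2 rfl (hb (m + 1))
      (by rw [← hgb (m + 2) (by omega)]; exact hgmono _ _ (towE_pos _) hx.1.le)
      (by rw [← hgb (m + 3) (by omega)]
          exact hgmono _ _ ((towE_pos _).trans hx.1) hx.2)
      (hbD (m + 3) (by omega))
  have hlow : ∀ m : ℕ, ENNReal.ofReal (1 / b (m + 3)) ≤
      ∫⁻ x in Ioc (towE (m + 2)) (towE (m + 3)),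
        ENNReal.ofReal (Real.log (F g x) / (x * F g x)) := by
    intro m
    have h0 : 0 ≤ 1 / b (m + 3) := one_div_nonneg.2 (by linarith [hb (m + 2)])
    calc ENNReal.ofReal (1 / b (m + 3)) = ∫⁻ x in Ioc (towE (m + 2)) (towE (m + 3)),
          ENNReal.ofReal (1 / b (m + 3)) *
            ENNReal.ofReal (1 / ∏ i ∈ Finset.range (m + 3), iterLog i x) := by
          rw [lintegral_const_mul' _ _ ENNReal.ofReal_ne_top, lint_one (m + 2), mul_one]
      _ ≤ _ := by
          refine setLIntegral_mono' measurableSet_Ioc fun x hx => ?_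
          rw [← ENNReal.ofReal_mul h0]
          exact ENNReal.ofReal_le_ofReal (hbd m x hx).1
  have hup : ∀ m : ℕ, ∫⁻ x in Ioc (towE (m + 2)) (towE (m + 3)),
        ENNReal.ofReal (Real.log (F g x) / (x * F g x)) ≤
        ENNReal.ofReal (4 + |Real.log D|) * ENNReal.ofReal (1 / b (m + 2)) := by
    intro m
    have hc : 0 ≤ 4 + |Real.log D| := by positivity
    have h0 : 0 ≤ (4 + |Real.log D|) / b (m + 2) := div_nonneg hc (by linarith [hb (m + 1)])
    rw [← ENNReal.ofReal_mul hc, mul_one_div]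
    calc _ ≤ ∫⁻ x in Ioc (towE (m + 2)) (towE (m + 3)),
          ENNReal.ofReal ((4 + |Real.log D|) / b (m + 2)) *
            ENNReal.ofReal (1 / ∏ i ∈ Finset.range (m + 3), iterLog i x) := by
          refine setLIntegral_mono' measurableSet_Ioc fun x hx => ?_
          rw [← ENNReal.ofReal_mul h0]
          exact ENNReal.ofReal_le_ofReal (hbd m x hx).2
      _ = _ := by
          rw [lintegral_const_mul' _ _ ENNReal.ofReal_ne_top, lint_one (m + 2), mul_one]
  constructor
  · intro h
    have h1 := ENNReal.tsum_le_tsum hup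
    rw [h, ENNReal.tsum_mul_left, top_le_iff] at h1
    have h2 : ∑' m : ℕ, ENNReal.ofReal (1 / b (m + 2)) = ⊤ := by
      by_contra hne
      exact ENNReal.mul_ne_top ENNReal.ofReal_ne_top hne h1
    have h3 := ENNReal.tsum_comp_le_tsum_of_injective (add_left_injective 1)
      (fun n : ℕ => ENNReal.ofReal (1 / b (n + 1)))
    rw [← top_le_iff, ← h2]
    exact h3
  · intro h
    have h1 := ENNReal.tsum_le_tsum hlow
    have h2 : ∑' m : ℕ, ENNReal.ofReal (1 / b (m + 3)) = ⊤ := by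
      by_contra hne
      have h3 := Summable.sum_add_tsum_nat_add' (f := fun n : ℕ => ENNReal.ofReal (1 / b (n + 1)))
        (k := 2) ENNReal.summable
      rw [h] at h3
      refine ENNReal.add_ne_top.2 ⟨?_, hne⟩ h3
      exact (ENNReal.sum_lt_top.2 fun _ _ => ENNReal.ofReal_lt_top).ne
    rw [h2, top_le_iff] at h1
    exact h1
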